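/- Let A be a finite abelian group, m ≥ 1, n ≥ 0 with m+n ≥ 2, and consider F(m,n) = {(y₁,…,y_m,z₁,…,z_n) ∈ A^{m+n} : y₁+⋯+y_m + 2z₁+⋯+2z_n = 0}. Let F_nz(m,n) be the subset where all coordinates are nonzero. Then |F_nz(m,n)| = (|A|−1)^{m+n−1} − |F_nz(m−1,n)|. -/

import Mathlib

open Finset

/-- Nowhere-zero flows of the signed graph `Σ_{m,n}` with one vertex, `m`
outer-edges and `n` negative loops, with coefficients in `A`: tuples of
nonzero elements with `y₁ + ⋯ + y_m + 2z₁ + ⋯ + 2z_n = 0`. -/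
def FnzMN (A : Type*) [AddCommGroup A] (m n : ℕ) :
    Set ((Fin m → A) × (Fin n → A)) :=
  {p | (∀ i, p.1 i ≠ 0) ∧ (∀ j, p.2 j ≠ 0) ∧ (∑ i, p.1 i) + ∑ j, 2 • p.2 j = 0}

/-- Nowhere-zero tuples without the flow condition. -/
def NZaux (A : Type*) [AddCommGroup A] (m n : ℕ) :
    Set ((Fin m → A) × (Fin n → A)) :=
  {p | (∀ i, p.1 i ≠ 0) ∧ (∀ j, p.2 j ≠ 0)}

def NZauxEquiv (A : Type*) [AddCommGroup A] (m n : ℕ) :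
    NZaux A m n ≃ (Fin m → {a : A // a ≠ 0}) × (Fin n → {a : A // a ≠ 0}) where
  toFun p := (fun i => ⟨p.1.1 i, p.2.1 i⟩, fun j => ⟨p.1.2 j, p.2.2 j⟩)
  invFun q := ⟨(fun i => (q.1 i).1, fun j => (q.2 j).1),
    fun i => (q.1 i).2, fun j => (q.2 j).2⟩
  left_inv _ := rfl
  right_inv _ := rfl

theorem NZaux_card (A : Type*) [AddCommGroup A] [Fintype A] (m n : ℕ) :
    (Nat.card (NZaux A m n) : ℤ) = ((Fintype.card A : ℤ) - 1) ^ (m + n) := by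
  classical
  have h1 : 1 ≤ Fintype.card A := Fintype.card_pos
  have h2 : Fintype.card {a : A // a ≠ 0} = Fintype.card A - 1 := by
    rw [Fintype.card_subtype_compl]; simp
  rw [Nat.card_congr (NZauxEquiv A m n), Nat.card_eq_fintype_card, Fintype.card_prod,
    Fintype.card_fun, Fintype.card_fun, h2, Fintype.card_fin, Fintype.card_fin, ← pow_add]
  push_cast [Nat.cast_sub h1]
  rfl

def FnzSuccEquiv (A : Type*) [AddCommGroup A] (m n : ℕ) :
    FnzMN A (m + 1) n ≃ (NZaux A m n \ FnzMN A m n : Set _) where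
  toFun p := ⟨(fun i => p.1.1 i.succ, p.1.2),
    ⟨fun i => p.2.1 i.succ, p.2.2.1⟩, fun h => by
      have h3 := p.2.2.2
      have h4 := h.2.2
      rw [Fin.sum_univ_succ, add_assoc] at h3
      simp only at h4
      rw [h4, add_zero] at h3
      exact p.2.1 0 h3⟩
  invFun q := ⟨(Fin.cons (-((∑ i, q.1.1 i) + ∑ j, 2 • q.1.2 j)) q.1.1, q.1.2), by
    refine ⟨fun i => ?_, q.2.1.2, ?_⟩
    · refine Fin.cases ?_ (fun i => ?_) i
      · intro h
        exact q.2.2 ⟨q.2.1.1, q.2.1.2, neg_eq_zero.1 h⟩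
      · exact q.2.1.1 i
    · simp only [Fin.sum_univ_succ, Fin.cons_zero, Fin.cons_succ]
      abel⟩
  left_inv p := by
    apply Subtype.ext
    refine Prod.ext ?_ rfl
    funext i
    refine Fin.cases ?_ (fun i => ?_) i
    · have h3 := p.2.2.2
      rw [Fin.sum_univ_succ, add_assoc] at h3
      exact (eq_neg_of_add_eq_zero_left h3).symm
    · rfl
  right_inv q := rfl

/-- The recurrence `|F_nz(m,n)| = (|A|−1)^{m+n−1} − |F_nz(m−1,n)|` for
`m ≥ 1`, `m + n ≥ 2`. -/
theorem stmt6 (A : Type*) [AddCommGroup A] [Fintype A] (m n : ℕ)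
    (hm : 1 ≤ m) (hmn : 2 ≤ m + n) :
    (Nat.card (FnzMN A m n) : ℤ) =
      ((Fintype.card A : ℤ) - 1) ^ (m + n - 1) - Nat.card (FnzMN A (m - 1) n) := by
  obtain ⟨k, rfl⟩ : ∃ k, m = k + 1 := ⟨m - 1, by omega⟩
  have e : k + 1 + n - 1 = k + n := by omega
  rw [e, Nat.add_sub_cancel, ← NZaux_card, Nat.card_congr (FnzSuccEquiv A k n)]
  have hs : FnzMN A k n ⊆ NZaux A k n := fun p hp => ⟨hp.1, hp.2.1⟩
  have h := Set.ncard_sdiff_add_ncard_of_subset hs (Set.toFinite _)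
  simp only [← Nat.card_coe_set_eq] at h
  rw [← h]
  push_cast
  ring
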